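/- arXiv:2102.03311 — 4 statements merged into one kernel-verified Lean document; each statement's English description precedes it below -/
import Mathlib

section
/- Let ε ∈ (0, 0.2] be a fixed constant and let ProfilePacking use a parameter m ≥ 3·τ_k·k/ε. If the prediction is error-free (f' = f for every input σ), then ProfilePacking has asymptotic competitive ratio at most 1+ε; that is, lim_{n→∞} sup_{σ: |σ|=n} |PP(σ, f)| / |OPT(σ)| ≤ 1+ε. -/
open scoped BigOperators Classical

namespace BinPackingWithPredictions

/-! ## Offline bin packing with integral sizes -/

/-- `L` is a packing of the multiset `S` of item sizes into bins of capacity `k`: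
the bins (each a multiset of item sizes) partition `S`, and each bin has total size `≤ k`. -/
def IsPacking (k : ℕ) (S : Multiset ℕ) (L : Multiset (Multiset ℕ)) : Prop :=
  L.sum = S ∧ ∀ B ∈ L, B.sum ≤ k

/-- `OPT k S` is the minimum number of bins of capacity `k` needed to pack `S`. -/
noncomputable def OPT (k : ℕ) (S : Multiset ℕ) : ℕ :=
  sInf {N | ∃ L, IsPacking k S L ∧ L.card = N}

/-- A valid input sequence: every item size is an integer in `[1,k]`. -/
def ValidSeq (k : ℕ) (σ : List ℕ) : Prop := ∀ a ∈ σ, 1 ≤ a ∧ a ≤ k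

/-- The frequency of size `x` in `σ`. -/
noncomputable def freq (σ : List ℕ) (x : ℕ) : ℝ := (σ.count x : ℝ) / (σ.length : ℝ)

/-- A valid prediction vector: `f' x ∈ [0,1]` for every size `x ∈ [1,k]`. -/
def ValidPred (k : ℕ) (f' : ℕ → ℝ) : Prop := ∀ x ∈ Finset.Icc 1 k, 0 ≤ f' x ∧ f' x ≤ 1

/-- The prediction error: the L1 distance between the true frequencies and the prediction. -/
noncomputable def errOf (k : ℕ) (σ : List ℕ) (f' : ℕ → ℝ) : ℝ :=
  ∑ x ∈ Finset.Icc 1 k, |freq σ x - f' x|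

/-- The number `τ_k` of bin types for capacity `k`: a bin type is determined by the
multiset of its placeholders (integers in `[1,k]` of total at most `k`). -/
noncomputable def numBinTypes (k : ℕ) : ℕ :=
  Set.ncard {T : Multiset ℕ | (∀ s ∈ T, 1 ≤ s ∧ s ≤ k) ∧ T.sum ≤ k}

/-- The input class in which at most `r` items fit into a bin: every `r+1` items
of the input have total size exceeding `k`. -/
def AtMostPerBin (k r : ℕ) (σ : List ℕ) : Prop :=
  ∀ S : Multiset ℕ, S ≤ ↑σ → S.card = r + 1 → k < S.sum

/-! ## FirstFit -/

/-- One step of FirstFit: place an item of size `x` into the first bin (the bins are listed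
with their current loads, in the order they were opened) where it fits; open a new bin
if it fits nowhere. -/
def ffStep (k : ℕ) : List ℕ → ℕ → List ℕ
  | [], x => [x]
  | b :: rest, x => if b + x ≤ k then (b + x) :: rest else b :: ffStep k rest x

/-- The number of bins FirstFit opens on the sequence `σ` with bins of capacity `k`. -/
def FF (k : ℕ) (σ : List ℕ) : ℕ := (σ.foldl (ffStep k) []).length

/-! ## ProfilePacking -/

/-- The profile multiset: `⌈f' x * m⌉` items of size `x` for each `x ∈ [1,k]`. -/
noncomputable def profile (k m : ℕ) (f' : ℕ → ℝ) : Multiset ℕ :=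
  ∑ x ∈ Finset.Icc 1 k, Multiset.replicate ⌈f' x * (m : ℝ)⌉₊ x

/-- The number of placeholders of bin `b` of group `g` that are occupied by items of size `x`
among the first `i` (non-special) items, under the placeholder assignment `assign`. -/
def occupied (σ : List ℕ) (assign : ℕ → Option (ℕ × ℕ)) (i g b x : ℕ) : ℕ :=
  ((Finset.range i).filter fun j => assign j = some (g, b) ∧ σ.getD j 0 = x).card

/-- After the first `i` items there is a free placeholder of size `x` in one of the
first `G` profile groups. -/
def hasFree (types : List (Multiset ℕ)) (σ : List ℕ) (assign : ℕ → Option (ℕ × ℕ))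
    (i G x : ℕ) : Prop :=
  ∃ g < G, ∃ b < types.length, occupied σ assign i g b x < (types.getD b 0).count x

/-- The number of profile groups (virtually) opened by ProfilePacking after serving the
first `i` items: one group is opened at the start, and a new group is opened exactly when a
non-special item finds no free placeholder of its size. -/
noncomputable def groups (types : List (Multiset ℕ)) (σ : List ℕ) (f' : ℕ → ℝ)
    (assign : ℕ → Option (ℕ × ℕ)) : ℕ → ℕ
  | 0 => 1
  | i + 1 =>
      if f' (σ.getD i 0) = 0 ∨
          hasFree types σ assign i (groups types σ f' assign i) (σ.getD i 0) then
        groups types σ f' assign i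
      else groups types σ f' assign i + 1

/-- `types`, `assign` describe a (nondeterministic) run of ProfilePacking with parameter `m`
and prediction `f'` on the input `σ`:
`types` lists the bins of an optimal packing of the profile (the common type structure of
every profile group); every non-special item (and nothing else) is assigned a placeholder of
its own size, in a bin `b` of a group `g`; a group beyond the opened ones is used only when
no free placeholder of the item's size exists, in which case the new group is the next one. -/
def PPValid (k m : ℕ) (f' : ℕ → ℝ) (σ : List ℕ)
    (types : List (Multiset ℕ)) (assign : ℕ → Option (ℕ × ℕ)) : Prop :=
  IsPacking k (profile k m f') (↑types) ∧
  types.length = OPT k (profile k m f') ∧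
  (∀ i, (assign i).isSome ↔ (i < σ.length ∧ f' (σ.getD i 0) ≠ 0)) ∧
  ∀ i g b, assign i = some (g, b) →
    b < types.length ∧
    occupied σ assign i g b (σ.getD i 0) < (types.getD b 0).count (σ.getD i 0) ∧
    g < groups types σ f' assign (i + 1) ∧
    (¬ hasFree types σ assign i (groups types σ f' assign i) (σ.getD i 0) →
      g = groups types σ f' assign i)

/-- The special items of `σ`: those whose size has predicted frequency `0`. -/
noncomputable def specials (f' : ℕ → ℝ) (σ : List ℕ) : List ℕ :=
  σ.filter fun a => decide (f' a = 0)

/-- The cost of a run of ProfilePacking: bins are opened lazily, so only the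
placeholder bins that actually receive an item are counted, plus the bins that
FirstFit opens for the special items (packed separately). -/
noncomputable def PPcost (k : ℕ) (f' : ℕ → ℝ) (σ : List ℕ)
    (assign : ℕ → Option (ℕ × ℕ)) : ℕ :=
  Set.ncard {gb : ℕ × ℕ | ∃ i, assign i = some gb} + FF k (specials f' σ)




lemma packing_of_le (k : ℕ) (L : Multiset (Multiset ℕ)) :
    ∀ S : Multiset ℕ, S ≤ L.sum → (∀ B ∈ L, B.sum ≤ k) →
      ∃ L', IsPacking k S L' ∧ L'.card = L.card := by
  induction L using Multiset.induction_on with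
  | empty =>
    intro S hS _
    refine ⟨0, ⟨?_, by simp⟩, rfl⟩
    simp at hS
    simp [hS]
  | cons B L ih =>
    intro S hS hB
    have h1 : S - B ≤ L.sum := by
      rw [Multiset.sum_cons] at hS
      exact tsub_le_iff_left.mpr hS
    obtain ⟨L', ⟨h2, h3⟩, h4⟩ := ih (S - B) h1 (fun C hC => hB C (Multiset.mem_cons_of_mem hC))
    refine ⟨(S ∩ B) ::ₘ L', ⟨?_, ?_⟩, by simp [h4]⟩
    · rw [Multiset.sum_cons, h2]
      ext x
      simp only [Multiset.count_add, Multiset.count_inter, Multiset.count_sub]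
      omega
    · intro C hC
      rcases Multiset.mem_cons.mp hC with rfl | hC
      · have h5 : (S ∩ B) ≤ B := Multiset.inter_le_right
        obtain ⟨D, hD⟩ := Multiset.le_iff_exists_add.mp h5
        have := hB B (Multiset.mem_cons_self _ _)
        have h6 := congrArg Multiset.sum hD
        rw [Multiset.sum_add] at h6
        omega
      · exact h3 C hC

lemma OPT_le_of_le (k : ℕ) (L : Multiset (Multiset ℕ)) (S : Multiset ℕ) (h : S ≤ L.sum)
    (hB : ∀ B ∈ L, B.sum ≤ k) : OPT k S ≤ L.card := by
  obtain ⟨L', h1, h2⟩ := packing_of_le k L S h hB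
  exact Nat.sInf_le ⟨L', h1, h2⟩

lemma exists_opt (k : ℕ) (σ : List ℕ) (hv : ValidSeq k σ) :
    ∃ L, IsPacking k (↑σ) L ∧ L.card = OPT k ↑σ := by
  have : OPT k ↑σ ∈ {N | ∃ L, IsPacking k (↑σ) L ∧ L.card = N} := by
    apply Nat.sInf_mem
    refine ⟨_, (↑σ : Multiset ℕ).map (fun a => {a}), ⟨?_, ?_⟩, rfl⟩
    · exact Multiset.sum_map_singleton _
    · intro B hB
      obtain ⟨a, ha, rfl⟩ := Multiset.mem_map.mp hB
      simpa using (hv a (by simpa using ha)).2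
  exact this

lemma length_le (k : ℕ) (σ : List ℕ) (hv : ValidSeq k σ) : σ.length ≤ k * OPT k ↑σ := by
  obtain ⟨L, ⟨h1, h2⟩, h3⟩ := exists_opt k σ hv
  have ha : σ.length ≤ σ.sum := by
    have := List.card_nsmul_le_sum σ 1 (fun x hx => (hv x hx).1)
    simpa using this
  have hb : ∀ L : Multiset (Multiset ℕ), (∀ B ∈ L, B.sum ≤ k) → L.sum.sum ≤ k * L.card := by
    intro L
    induction L using Multiset.induction_on with
    | empty => simp
    | cons B L ih =>
      intro h
      have e1 := ih (fun C hC => h C (Multiset.mem_cons_of_mem hC))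
      have e2 := h B (Multiset.mem_cons_self _ _)
      simp only [Multiset.sum_cons, Multiset.sum_add, Multiset.card_cons]
      nlinarith
  have hc := hb L h2
  rw [h1, h3, Multiset.sum_coe] at hc
  omega

lemma finite_types (k : ℕ) :
    {T : Multiset ℕ | (∀ s ∈ T, 1 ≤ s ∧ s ≤ k) ∧ T.sum ≤ k}.Finite := by
  apply (Set.finite_Iic (k • (Finset.Icc 1 k).val)).subset
  rintro T ⟨h1, h2⟩
  rw [Set.mem_Iic, Multiset.le_iff_count]
  intro a
  by_cases ha : a ∈ T
  · have h3 : T.card ≤ T.sum := by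
      have := Multiset.card_nsmul_le_sum (s := T) (a := 1) (fun x hx => (h1 x hx).1)
      simpa using this
    have h4 := Multiset.count_le_card a T
    have h5 : Multiset.count a (Finset.Icc 1 k).val = 1 :=
      Multiset.count_eq_one_of_mem (Finset.Icc 1 k).nodup (by simpa using h1 a ha)
    rw [Multiset.count_nsmul, h5]
    omega
  · simp [Multiset.count_eq_zero_of_notMem ha]

lemma numBinTypes_pos (k : ℕ) : 1 ≤ numBinTypes k := by
  unfold numBinTypes
  exact (Set.ncard_pos (finite_types k)).mpr ⟨0, by simp⟩

lemma count_profile (k m : ℕ) (f : ℕ → ℝ) (x : ℕ) (hx : x ∈ Finset.Icc 1 k) :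
    (profile k m f).count x = ⌈f x * m⌉₊ := by
  unfold profile
  rw [Multiset.count_sum']
  simp only [Multiset.count_replicate]
  rw [Finset.sum_ite_eq' ]
  simp only [hx, if_true]

lemma count_profile_not (k m : ℕ) (f : ℕ → ℝ) (x : ℕ) (hx : x ∉ Finset.Icc 1 k) :
    (profile k m f).count x = 0 := by
  unfold profile
  rw [Multiset.count_sum']
  simp only [Multiset.count_replicate]
  rw [Finset.sum_ite_eq' ]
  simp only [hx, if_false]

lemma OPT_profile_le (k m : ℕ) (σ : List ℕ) (hv : ValidSeq k σ) :
    (OPT k (profile k m (freq σ)) : ℝ) ≤ OPT k ↑σ * (m / σ.length) + numBinTypes k := by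
  obtain ⟨L, ⟨h1, h2⟩, h3⟩ := exists_opt k σ hv
  set c : ℝ := m / σ.length with hc
  have hc0 : 0 ≤ c := by positivity
  set L' : Multiset (Multiset ℕ) :=
    ∑ T ∈ L.toFinset, Multiset.replicate ⌈(L.count T : ℝ) * c⌉₊ T with hL'
  have hle : OPT k (profile k m (freq σ)) ≤ L'.card := by
    apply OPT_le_of_le
    · rw [Multiset.le_iff_count]
      intro x
      by_cases hx : x ∈ Finset.Icc 1 k
      · rw [count_profile _ _ _ _ hx, Nat.ceil_le]
        have e1 : L'.sum = ∑ T ∈ L.toFinset, ⌈(L.count T : ℝ) * c⌉₊ • T := by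
          rw [hL', Multiset.sum_sum]
          simp
        have e2 : σ.count x = ∑ T ∈ L.toFinset, L.count T * T.count x := by
          rw [← Multiset.coe_count, ← h1, Finset.sum_multiset_count, Multiset.count_sum']
          simp
        rw [e1, Multiset.count_sum']
        simp only [Multiset.count_nsmul]
        have e3 : freq σ x * m = (σ.count x : ℝ) * c := by
          unfold freq; rw [hc]; ring
        rw [e3, e2]
        push_cast
        rw [Finset.sum_mul]
        apply Finset.sum_le_sum
        intro T _
        have := Nat.le_ceil ((L.count T : ℝ) * c)
        have h0 : (0 : ℝ) ≤ T.count x := by positivity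
        nlinarith
      · rw [count_profile_not _ _ _ _ hx]; exact Nat.zero_le _
    · intro B hB
      rw [hL', Multiset.mem_sum] at hB
      obtain ⟨T, hT, hB⟩ := hB
      rw [Multiset.eq_of_mem_replicate hB]
      exact h2 T (by simpa using hT)
  have hcard : (L'.card : ℝ) ≤ L.card * c + L.toFinset.card := by
    rw [hL', Multiset.card_sum]
    simp only [Multiset.card_replicate]
    have : (L.card : ℝ) = ∑ T ∈ L.toFinset, (L.count T : ℝ) := by
      rw [← Multiset.toFinset_sum_count_eq]; push_cast; rfl
    rw [this, Finset.sum_mul]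
    push_cast
    rw [Finset.card_eq_sum_ones, Nat.cast_sum, ← Finset.sum_add_distrib]
    apply Finset.sum_le_sum
    intro T _
    have := Nat.ceil_lt_add_one (a := (L.count T : ℝ) * c) (by positivity)
    push_cast
    linarith
  have htypes : L.toFinset.card ≤ numBinTypes k := by
    unfold numBinTypes
    rw [← Set.ncard_coe_finset]
    apply Set.ncard_le_ncard _ (finite_types k)
    intro T hT
    have hT' : T ∈ L := by simpa using hT
    refine ⟨fun s hs => hv s ?_, h2 T hT'⟩
    have : T ≤ L.sum := Multiset.single_le_sum (fun _ _ => Multiset.zero_le _) T hT'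
    rw [h1] at this
    simpa using Multiset.mem_of_le this hs
  have hle' : (OPT k (profile k m (freq σ)) : ℝ) ≤ L'.card := by exact_mod_cast hle
  have ht' : (L.toFinset.card : ℝ) ≤ numBinTypes k := by exact_mod_cast htypes
  rw [← h3]
  linarith

lemma occ_sum_le (σ : List ℕ) (assign : ℕ → Option (ℕ × ℕ)) (i G l x : ℕ) (hi : i ≤ σ.length) :
    ∑ g ∈ Finset.range G, ∑ b ∈ Finset.range l, occupied σ assign i g b x ≤ σ.count x := by
  have h1 : ∑ g ∈ Finset.range G, ∑ b ∈ Finset.range l, occupied σ assign i g b x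
      ≤ ((Finset.range i).filter fun j => σ.getD j 0 = x).card := by
    rw [← Finset.sum_product']
    unfold occupied
    rw [← Finset.card_biUnion]
    · apply Finset.card_le_card
      intro j hj
      simp only [Finset.mem_biUnion, Finset.mem_filter] at hj ⊢
      obtain ⟨_, _, h, _, h'⟩ := hj
      exact ⟨h, h'⟩
    · intro p _ q _ hpq
      rw [Function.onFun, Finset.disjoint_left]
      intro j hj hj'
      simp only [Finset.mem_filter] at hj hj'
      apply hpq
      have := hj.2.1.symm.trans hj'.2.1
      simpa using this
  have h2 : ((Finset.range i).filter fun j => σ.getD j 0 = x).card ≤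
      ((Finset.range σ.length).filter fun j => σ.getD j 0 = x).card := by
    apply Finset.card_le_card
    apply Finset.filter_subset_filter
    simpa using hi
  have h3 : ∀ σ : List ℕ, ((Finset.range σ.length).filter fun j => σ.getD j 0 = x).card
      = σ.count x := by
    intro σ
    induction σ with
    | nil => simp
    | cons a t ih =>
      rw [Finset.card_filter] at ih ⊢
      rw [List.length_cons, Finset.sum_range_succ', List.count_cons, ← ih]
      simp
  rw [h3] at h2
  exact h1.trans h2

lemma groups_mono (types : List (Multiset ℕ)) (σ : List ℕ) (f' : ℕ → ℝ)
    (assign : ℕ → Option (ℕ × ℕ)) : Monotone (groups types σ f' assign) := by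
  apply monotone_nat_of_le_succ
  intro i
  rw [groups]
  split_ifs <;> omega

lemma groups_bound (k m : ℕ) (σ : List ℕ) (hv : ValidSeq k σ) (hn : 0 < σ.length)
    (types : List (Multiset ℕ))
    (assign : ℕ → Option (ℕ × ℕ)) (hp : IsPacking k (profile k m (freq σ)) (↑types)) (i : ℕ) :
    ((groups types σ (freq σ) assign i : ℝ) - 1) * m ≤ σ.length := by
  induction i with
  | zero => simp [groups]
  | succ i ih =>
    rw [groups]
    split_ifs with h
    · exact ih
    · push Not at h
      obtain ⟨hf, hfree⟩ := h
      set x := σ.getD i 0 with hx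
      set G := groups types σ (freq σ) assign i
      have hcount : 0 < σ.count x := by
        rcases Nat.eq_zero_or_pos (σ.count x) with h0 | h0
        · exfalso; apply hf; simp [freq, h0]
        · exact h0
      have hmem : x ∈ σ := List.count_pos_iff.mp hcount
      have hxk : x ∈ Finset.Icc 1 k := by simpa using hv x hmem
      have hi : i ≤ σ.length := by
        by_contra hcon
        have : x = 0 := by
          rw [hx]; apply List.getD_eq_default; omega
        have := (hv x hmem).1
        omega
      have hocc := occ_sum_le σ assign i G types.length x hi
      unfold hasFree at hfree
      push Not at hfree
      have hpx : ∑ b ∈ Finset.range types.length, (types.getD b 0).count x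
          = ⌈freq σ x * m⌉₊ := by
        rw [← count_profile k m (freq σ) x hxk, ← hp.1, Multiset.sum_coe]
        clear * -
        induction types with
        | nil => simp
        | cons a t ih =>
          rw [List.length_cons, Finset.sum_range_succ', List.sum_cons, Multiset.count_add, ← ih]
          simp [add_comm]
      have h1 : G * ⌈freq σ x * m⌉₊ ≤ σ.count x := by
        refine le_trans ?_ hocc
        rw [← hpx]
        calc G * _ = ∑ g ∈ Finset.range G,
              ∑ b ∈ Finset.range types.length, (types.getD b 0).count x := by simp
          _ ≤ _ := by
            apply Finset.sum_le_sum
            intro g hg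
            apply Finset.sum_le_sum
            intro b hb
            exact hfree g (by simpa using hg) b (by simpa using hb)
      have h2 : (G : ℝ) * (freq σ x * m) ≤ σ.count x := by
        have h3 : (G : ℝ) * ⌈freq σ x * m⌉₊ ≤ σ.count x := by exact_mod_cast h1
        refine le_trans ?_ h3
        gcongr
        exact Nat.le_ceil _
      have hc' : (0 : ℝ) < σ.count x := by exact_mod_cast hcount
      have hn' : (0 : ℝ) < σ.length := by exact_mod_cast hn
      unfold freq at h2
      have h4 : (G : ℝ) * (σ.count x / σ.length * m) = (σ.count x) * (G * m / σ.length) := by ring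
      rw [h4] at h2
      have h5 : (G * m / σ.length : ℝ) ≤ 1 := by
        by_contra hcon
        push Not at hcon
        nlinarith
      rw [div_le_one hn'] at h5
      push_cast
      linarith

lemma specials_nil (σ : List ℕ) : specials (freq σ) σ = [] := by
  unfold specials
  rw [List.filter_eq_nil_iff]
  intro a ha
  have h1 : 0 < σ.count a := List.count_pos_iff.mpr ha
  have h2 : 0 < σ.length := List.length_pos_of_mem ha
  simp only [decide_eq_true_eq]
  unfold freq
  positivity

lemma cost_le (k m : ℕ) (hm : 0 < m) (σ : List ℕ) (hv : ValidSeq k σ) (hn : 0 < σ.length)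
    (types : List (Multiset ℕ)) (assign : ℕ → Option (ℕ × ℕ))
    (hp : PPValid k m (freq σ) σ types assign) :
    (PPcost k (freq σ) σ assign : ℝ) ≤
      (σ.length / m + 1) * (OPT k ↑σ * (m / σ.length) + numBinTypes k) := by
  obtain ⟨h1, h2, h3, h4⟩ := hp
  have hb := groups_bound k m σ hv hn types assign h1 σ.length
  set G := groups types σ (freq σ) assign σ.length with hG
  have hcost : PPcost k (freq σ) σ assign ≤ G * types.length := by
    unfold PPcost
    rw [specials_nil]
    have : FF k [] = 0 := rfl
    rw [this, add_zero]
    have hs : {gb : ℕ × ℕ | ∃ i, assign i = some gb} ⊆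
        ↑(Finset.range G ×ˢ Finset.range types.length) := by
      rintro ⟨g, b⟩ ⟨i, hi⟩
      obtain ⟨q1, q2, q3, q4⟩ := h4 i g b hi
      have hi' : i < σ.length := ((h3 i).mp (by simp [hi])).1
      have := groups_mono types σ (freq σ) assign (show i + 1 ≤ σ.length by omega)
      simp only [Finset.coe_product, Set.mem_prod, Finset.coe_range, Set.mem_Iio]
      exact ⟨by omega, q1⟩
    have := Set.ncard_le_ncard hs (Finset.finite_toSet _)
    rw [Set.ncard_coe_finset] at this
    simpa using this
  have hm' : (0 : ℝ) < m := by exact_mod_cast hm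
  have hG' : (G : ℝ) ≤ σ.length / m + 1 := by
    have := (le_div_iff₀ hm').mpr hb
    linarith
  have hO := OPT_profile_le k m σ hv
  rw [← h2] at hO
  calc (PPcost k (freq σ) σ assign : ℝ) ≤ G * types.length := by exact_mod_cast hcost
    _ ≤ _ := by gcongr

theorem profilePacking_error_free
    (k : ℕ) (hk : 1 ≤ k) (ε : ℝ) (hε0 : 0 < ε) (hε : ε ≤ 0.2)
    (m : ℕ) (hm : (3 : ℝ) * numBinTypes k * k / ε ≤ m) :
    Filter.limsup (fun n : ℕ =>
        sSup {r : ℝ | ∃ (σ : List ℕ) (types : List (Multiset ℕ))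
            (assign : ℕ → Option (ℕ × ℕ)),
          σ.length = n ∧ ValidSeq k σ ∧
          PPValid k m (freq σ) σ types assign ∧
          r = (PPcost k (freq σ) σ assign : ℝ) / (OPT k ↑σ : ℝ)})
      Filter.atTop ≤ 1 + ε := by
  have hτ : (1 : ℝ) ≤ numBinTypes k := by exact_mod_cast numBinTypes_pos k
  have hk' : (1 : ℝ) ≤ k := by exact_mod_cast hk
  have hmR : (0 : ℝ) < m := lt_of_lt_of_le (by positivity) hm
  have hmN : 0 < m := by exact_mod_cast hmR
  have hm2 : 3 * (numBinTypes k * k / m : ℝ) ≤ ε := by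
    rw [div_le_iff₀ hε0] at hm
    rw [mul_div_assoc', div_le_iff₀ hmR]
    linarith
  apply Filter.limsup_le_of_le
  · refine Filter.IsBoundedUnder.isCoboundedUnder_le ⟨0, ?_⟩
    rw [Filter.eventually_map]
    refine Filter.Eventually.of_forall fun n => ?_
    apply Real.sSup_nonneg
    rintro r ⟨σ, types, assign, -, -, -, rfl⟩
    positivity
  · obtain ⟨N, hN⟩ := exists_nat_gt ((m + numBinTypes k * k) / (2 / 3 * ε) : ℝ)
    filter_upwards [Filter.eventually_ge_atTop (N + 1)] with n hn
    apply Real.sSup_le _ (by positivity)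
    rintro r ⟨σ, types, assign, hlen, hv, hp, rfl⟩
    have hn0 : 0 < σ.length := by omega
    have hc := cost_le k m hmN σ hv hn0 types assign hp
    have hl := length_le k σ hv
    have hOpos : 0 < OPT k ↑σ := by
      rcases Nat.eq_zero_or_pos (OPT k ↑σ) with h | h
      · rw [h] at hl; omega
      · exact h
    rw [hlen] at hc hl
    have hO : (0 : ℝ) < OPT k ↑σ := by exact_mod_cast hOpos
    have hl' : (n : ℝ) ≤ k * OPT k ↑σ := by exact_mod_cast hl
    have hnR : (0 : ℝ) < n := by rw [hlen] at hn0; exact_mod_cast hn0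
    have hNn : (N : ℝ) ≤ n := by exact_mod_cast (by omega : N ≤ n)
    have hbig : ((m + numBinTypes k * k) / n : ℝ) ≤ 2 / 3 * ε := by
      rw [div_lt_iff₀ (by positivity)] at hN
      rw [div_le_iff₀ hnR]
      nlinarith
    rw [div_le_iff₀ hO]
    refine hc.trans ?_
    set O : ℝ := (OPT k ↑σ : ℝ)
    set t : ℝ := (numBinTypes k : ℝ)
    have e1 : ((n : ℝ) / m + 1) * (O * (m / n) + t) = O + (t / m) * n + O * (m / n) + t := by
      field_simp
      ring
    have e2 : (t / m) * n ≤ (t * k / m) * O := by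
      calc (t / m) * n ≤ (t / m) * (k * O) := by gcongr
        _ = _ := by ring
    have e3 : t ≤ (t * k / n) * O := by
      rw [div_mul_eq_mul_div, le_div_iff₀ hnR]
      nlinarith
    have e4 : (m / n + t * k / n : ℝ) ≤ 2 / 3 * ε := by rw [← add_div]; exact hbig
    rw [e1]
    nlinarith [mul_le_mul_of_nonneg_right e4 hO.le, mul_le_mul_of_nonneg_right hm2 hO.le]

end BinPackingWithPredictions
end

section
/- Fix a constant c < 1 and an integer k ≥ 2. For any α with 0 < α ≤ c/k, every online algorithm with frequency predictions whose consistency is at most 1+α has robustness at least (1−c)·k/2. -/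
open scoped BigOperators Classical

namespace BinPackingWithPredictions

/-! ## Online algorithms (with and without frequency predictions) -/

/-- An online algorithm with frequency predictions is a function that, given the prediction
vector and the sequence of items revealed so far (ending with the current item), returns the
index of the bin receiving the current item.  `pAssign A f' σ i` is the bin receiving the
`i`-th item of `σ`. -/
def pAssign (A : (ℕ → ℝ) → List ℕ → ℕ) (f' : ℕ → ℝ) (σ : List ℕ) (i : ℕ) : ℕ :=
  A f' (σ.take (i + 1))

/-- The final load of bin `b`. -/
def pLoad (A : (ℕ → ℝ) → List ℕ → ℕ) (f' : ℕ → ℝ) (σ : List ℕ) (b : ℕ) : ℕ :=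
  ∑ i ∈ Finset.range σ.length, if pAssign A f' σ i = b then σ.getD i 0 else 0

/-- The algorithm never exceeds the bin capacity `k` on valid inputs. -/
def PFeasible (k : ℕ) (A : (ℕ → ℝ) → List ℕ → ℕ) : Prop :=
  ∀ f' σ, ValidPred k f' → ValidSeq k σ → ∀ b, pLoad A f' σ b ≤ k

/-- The number of bins the online algorithm `A` uses on `σ` with prediction `f'`. -/
def pCost (A : (ℕ → ℝ) → List ℕ → ℕ) (f' : ℕ → ℝ) (σ : List ℕ) : ℕ :=
  ((Finset.range σ.length).image (pAssign A f' σ)).card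

/-- An online algorithm without predictions, as a map from the revealed prefix
(ending with the current item) to the index of the bin receiving the current item. -/
def npAssign (A : List ℕ → ℕ) (σ : List ℕ) (i : ℕ) : ℕ := A (σ.take (i + 1))

def npLoad (A : List ℕ → ℕ) (σ : List ℕ) (b : ℕ) : ℕ :=
  ∑ i ∈ Finset.range σ.length, if npAssign A σ i = b then σ.getD i 0 else 0

def NPFeasible (k : ℕ) (A : List ℕ → ℕ) : Prop :=
  ∀ σ, ValidSeq k σ → ∀ b, npLoad A σ b ≤ k

def npCost (A : List ℕ → ℕ) (σ : List ℕ) : ℕ :=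
  ((Finset.range σ.length).image (npAssign A σ)).card



theorem OPT_le {k : ℕ} {S : Multiset ℕ} {L : Multiset (Multiset ℕ)} (h : IsPacking k S L) :
    OPT k S ≤ L.card := Nat.sInf_le ⟨L, h, rfl⟩

theorem sum_le_of_bins {k : ℕ} (L : Multiset (Multiset ℕ)) (h : ∀ B ∈ L, B.sum ≤ k) :
    L.sum.sum ≤ k * L.card := by
  induction L using Multiset.induction_on with
  | empty => simp
  | cons B L ih =>
    have h1 := h B (Multiset.mem_cons_self _ _)
    have h2 := ih (fun B' hB => h B' (Multiset.mem_cons_of_mem hB))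
    simp only [Multiset.sum_cons, Multiset.sum_add, Multiset.card_cons]
    linarith [mul_add k L.card 1]

theorem length_le_OPT {k : ℕ} {σ : List ℕ} (h : ValidSeq k σ) : σ.length ≤ k * OPT k ↑σ := by
  have hne : {N | ∃ L, IsPacking k (↑σ : Multiset ℕ) L ∧ L.card = N}.Nonempty := by
    refine ⟨_, (↑σ : Multiset ℕ).map (fun a => {a}), ⟨?_, ?_⟩, rfl⟩
    · exact Multiset.sum_map_singleton _
    · intro B hB
      obtain ⟨a, ha, rfl⟩ := Multiset.mem_map.1 hB
      simpa using (h a (by simpa using ha)).2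
  obtain ⟨L, ⟨hs, hb⟩, hc⟩ := Nat.sInf_mem hne
  have h1 := sum_le_of_bins L hb
  rw [hs, hc] at h1
  have h2 : σ.length ≤ σ.sum := by
    have := List.card_nsmul_le_sum σ 1 (fun x hx => (h x hx).1)
    simpa using this
  have : (↑σ : Multiset ℕ).sum = σ.sum := Multiset.sum_coe σ
  unfold OPT
  omega

theorem pCost_le (A : (ℕ → ℝ) → List ℕ → ℕ) (f' : ℕ → ℝ) (σ : List ℕ) :
    pCost A f' σ ≤ σ.length := by
  unfold pCost
  exact Finset.card_image_le.trans (by simp)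

theorem ratio_le {k : ℕ} (A : (ℕ → ℝ) → List ℕ → ℕ) (f' : ℕ → ℝ) {σ : List ℕ}
    (h : ValidSeq k σ) : (pCost A f' σ : ℝ) / (OPT k ↑σ : ℝ) ≤ k := by
  have h1 := pCost_le A f' σ
  have h2 := length_le_OPT h
  apply div_le_of_le_mul₀ (by positivity) (by positivity)
  exact_mod_cast h1.trans h2

theorem validPred_freq (k : ℕ) (σ : List ℕ) : ValidPred k (freq σ) := by
  intro x _
  unfold freq
  refine ⟨by positivity, ?_⟩
  apply div_le_one_of_le₀ _ (by positivity)
  exact_mod_cast List.count_le_length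

theorem load_sub {k : ℕ} {A : (ℕ → ℝ) → List ℕ → ℕ} (hfeas : PFeasible k A) {f' : ℕ → ℝ}
    {σ : List ℕ} (hp : ValidPred k f') (hv : ValidSeq k σ) (b : ℕ) (s : Finset ℕ)
    (hs : ∀ i ∈ s, i < σ.length ∧ pAssign A f' σ i = b) : ∑ i ∈ s, σ.getD i 0 ≤ k := by
  refine le_trans ?_ (hfeas f' σ hp hv b)
  unfold pLoad
  calc ∑ i ∈ s, σ.getD i 0
      = ∑ i ∈ s, (if pAssign A f' σ i = b then σ.getD i 0 else 0) :=
        Finset.sum_congr rfl (fun i hi => by rw [if_pos (hs i hi).2])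
    _ ≤ _ := Finset.sum_le_sum_of_subset (fun i hi => Finset.mem_range.2 (hs i hi).1)

theorem validSeq_ones {k : ℕ} (hk : 2 ≤ k) (m : ℕ) : ValidSeq k (List.replicate m 1) := by
  intro a ha
  have := List.eq_of_mem_replicate ha
  omega

theorem OPT_ones (k j : ℕ) : OPT k ↑(List.replicate (k * j) 1) ≤ j := by
  have h : IsPacking k ↑(List.replicate (k * j) 1)
      (Multiset.replicate j (Multiset.replicate k 1)) := by
    refine ⟨?_, ?_⟩
    · rw [Multiset.sum_replicate, Multiset.nsmul_replicate, Multiset.coe_replicate, mul_comm]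
    · intro B hB
      rw [Multiset.eq_of_mem_replicate hB]
      simp
  simpa using OPT_le h

def seq2 (k m : ℕ) : List ℕ := List.replicate m 1 ++ List.replicate m (k - 1)

theorem seq2_length (k m : ℕ) : (seq2 k m).length = 2 * m := by
  simp [seq2]; ring

theorem validSeq_seq2 {k : ℕ} (hk : 2 ≤ k) (m : ℕ) : ValidSeq k (seq2 k m) := by
  intro a ha
  rcases List.mem_append.1 ha with h | h <;> have := List.eq_of_mem_replicate h <;> omega

theorem OPT_seq2 {k : ℕ} (hk : 2 ≤ k) (m : ℕ) : OPT k ↑(seq2 k m) ≤ m := by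
  have h : IsPacking k ↑(seq2 k m) (Multiset.replicate m ({1} + {k - 1})) := by
    refine ⟨?_, ?_⟩
    · rw [Multiset.sum_replicate, nsmul_add, Multiset.nsmul_singleton, Multiset.nsmul_singleton,
        seq2, ← Multiset.coe_add, Multiset.coe_replicate, Multiset.coe_replicate]
    · intro B hB
      rw [Multiset.eq_of_mem_replicate hB]
      simp
      omega
  simpa using OPT_le h

theorem seq2_getD_lo {k m i : ℕ} (h : i < m) : (seq2 k m).getD i 0 = 1 := by
  simp [seq2, List.getD_eq_getElem?_getD, List.getElem?_append, h]

theorem seq2_getD_hi {k m i : ℕ} (h : m ≤ i) (h2 : i < 2 * m) :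
    (seq2 k m).getD i 0 = k - 1 := by
  have : i - m < m := by omega
  simp [seq2, List.getD_eq_getElem?_getD, List.getElem?_append, h.not_gt, this]

theorem pAssign_seq2 (A : (ℕ → ℝ) → List ℕ → ℕ) (f' : ℕ → ℝ) {k m i : ℕ} (h : i < m) :
    pAssign A f' (seq2 k m) i = pAssign A f' (List.replicate m 1) i := by
  unfold pAssign seq2
  rw [List.take_append_of_le_length (by simpa using h)]

theorem ones_cost {k : ℕ} (hk : 2 ≤ k) {A : (ℕ → ℝ) → List ℕ → ℕ} (hfeas : PFeasible k A)
    {f' : ℕ → ℝ} (hp : ValidPred k f') (m : ℕ) :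
    m ≤ k * pCost A f' (List.replicate m 1) := by
  have h := Finset.card_le_mul_card_image (f := pAssign A f' (List.replicate m 1))
    (Finset.range m) k ?_
  · simpa [pCost] using h
  · intro b _
    have := load_sub hfeas hp (validSeq_ones hk m) b
      {a ∈ Finset.range m | pAssign A f' (List.replicate m 1) a = b} (by simp)
    refine le_trans (le_of_eq ?_) this
    rw [Finset.card_eq_sum_ones]
    refine Finset.sum_congr rfl fun i hi => ?_
    have : i < m := by simpa using (Finset.mem_filter.1 hi).1
    simp [List.getD_eq_getElem?_getD, this]

/-- The key counting bound. -/
theorem key {k : ℕ} (hk : 3 ≤ k) {A : (ℕ → ℝ) → List ℕ → ℕ} (hfeas : PFeasible k A)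
    {f' : ℕ → ℝ} (hp : ValidPred k f') (m : ℕ) :
    m + k * m ≤ pCost A f' (List.replicate m 1) + k * pCost A f' (seq2 k m) := by
  set g := pAssign A f' (seq2 k m) with hg
  have hv := validSeq_seq2 (show 2 ≤ k by omega) m
  have hlen := seq2_length k m
  set F : ℕ → Finset ℕ := fun b => {i ∈ Finset.range m | g i = b} with hF
  set I1 := (Finset.range m).image g with hI1
  have hc1 : pCost A f' (List.replicate m 1) = I1.card := by
    unfold pCost
    rw [List.length_replicate, hI1]
    congr 1
    refine Finset.image_congr fun i hi => ?_
    exact (pAssign_seq2 A f' (by simpa using hi)).symm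
  set B2 := {b ∈ I1 | 2 ≤ (F b).card} with hB2
  set B1 := {b ∈ I1 | ¬ 2 ≤ (F b).card} with hB1
  set J := (Finset.Ico m (2 * m)).image g with hJ
  have hJc : J.card = m := by
    rw [hJ, Finset.card_image_of_injOn, Nat.card_Ico]
    · omega
    · intro i hi j hj hij
      simp only [Finset.coe_Ico, Set.mem_Ico] at hi hj
      by_contra hne
      have := load_sub hfeas hp hv (g i) {i, j} (by
        intro l hl
        rcases Finset.mem_insert.1 hl with rfl | hl
        · exact ⟨by omega, rfl⟩
        · rw [Finset.mem_singleton.1 hl]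
          exact ⟨by omega, hij.symm⟩)
      rw [Finset.sum_pair hne, seq2_getD_hi hi.1 hi.2, seq2_getD_hi hj.1 hj.2] at this
      omega
  have hdisj : Disjoint B2 J := by
    rw [Finset.disjoint_left]
    intro b hb hbJ
    obtain ⟨j, hj, hjb⟩ := Finset.mem_image.1 hbJ
    have h2 := (Finset.mem_filter.1 hb).2
    rw [Finset.mem_Ico] at hj
    have hjF : j ∉ F b := by
      intro h
      have := Finset.mem_range.1 (Finset.mem_filter.1 h).1
      omega
    have := load_sub hfeas hp hv b (insert j (F b)) (by
      intro l hl
      rcases Finset.mem_insert.1 hl with rfl | hl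
      · exact ⟨by omega, hjb⟩
      · have h3 := Finset.mem_filter.1 hl
        have := Finset.mem_range.1 h3.1
        exact ⟨by omega, h3.2⟩)
    rw [Finset.sum_insert hjF, seq2_getD_hi hj.1 hj.2] at this
    have h4 : ∑ i ∈ F b, (seq2 k m).getD i 0 = (F b).card := by
      rw [Finset.card_eq_sum_ones]
      refine Finset.sum_congr rfl fun i hi => ?_
      exact seq2_getD_lo (Finset.mem_range.1 (Finset.mem_filter.1 hi).1)
    omega
  have hcost : B2.card + m ≤ pCost A f' (seq2 k m) := by
    have h5 : (B2 ∪ J).card = B2.card + m := by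
      rw [Finset.card_union_of_disjoint hdisj, hJc]
    rw [← h5]
    unfold pCost
    refine Finset.card_le_card (Finset.union_subset ?_ ?_)
    · refine (Finset.filter_subset _ _).trans (Finset.image_subset_image ?_)
      intro i hi
      simp only [Finset.mem_range] at *
      omega
    · refine Finset.image_subset_image ?_
      intro i hi
      simp only [Finset.mem_range, Finset.mem_Ico] at *
      omega
  have hm : m = ∑ b ∈ I1, (F b).card := by
    have := Finset.card_eq_sum_card_image g (Finset.range m)
    simpa using this
  have hFk : ∀ b, (F b).card ≤ k := by
    intro b
    have := load_sub hfeas hp hv b (F b) (by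
      intro l hl
      have h3 := Finset.mem_filter.1 hl
      have := Finset.mem_range.1 h3.1
      exact ⟨by omega, h3.2⟩)
    refine le_trans (le_of_eq ?_) this
    rw [Finset.card_eq_sum_ones]
    refine Finset.sum_congr rfl fun i hi => ?_
    exact (seq2_getD_lo (Finset.mem_range.1 (Finset.mem_filter.1 hi).1)).symm
  have hsplit : ∑ b ∈ I1, (F b).card ≤ B2.card * k + B1.card * 1 := by
    rw [← Finset.sum_filter_add_sum_filter_not I1 (fun b => 2 ≤ (F b).card)]
    refine add_le_add ?_ ?_
    · exact Finset.sum_le_card_nsmul _ _ _ (fun b _ => hFk b)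
    · refine Finset.sum_le_card_nsmul _ _ _ (fun b hb => ?_)
      have := (Finset.mem_filter.1 hb).2
      omega
  have hB1le : B1.card ≤ I1.card := Finset.card_filter_le _ _
  rw [hc1]
  nlinarith [Nat.mul_le_mul_left k hcost]

/-- Fix a constant `c < 1` and an integer `k ≥ 2`.  For any `α` with
`0 < α ≤ c/k`, every online bin packing algorithm with frequency predictions whose
consistency is at most `1+α` has robustness at least `(1−c)·k/2`. -/
theorem consistency_robustness_tradeoff
    (k : ℕ) (hk : 2 ≤ k) (c : ℝ) (hc : c < 1)
    (α : ℝ) (hα0 : 0 < α) (hα : α ≤ c / k)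
    (A : (ℕ → ℝ) → List ℕ → ℕ) (hfeas : PFeasible k A)
    (hcons : Filter.limsup (fun n : ℕ =>
        sSup {r : ℝ | ∃ σ : List ℕ, σ.length = n ∧ ValidSeq k σ ∧
          r = (pCost A (freq σ) σ : ℝ) / (OPT k ↑σ : ℝ)}) Filter.atTop ≤ 1 + α) :
    (1 - c) * k / 2 ≤ Filter.limsup (fun n : ℕ =>
        sSup {r : ℝ | ∃ (σ : List ℕ) (f' : ℕ → ℝ), σ.length = n ∧ ValidSeq k σ ∧
          ValidPred k f' ∧ r = (pCost A f' σ : ℝ) / (OPT k ↑σ : ℝ)}) Filter.atTop := by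
  have hk0 : (0 : ℝ) < k := by exact_mod_cast (by omega : 0 < k)
  have hkα : k * α ≤ c := by rwa [le_div_iff₀ hk0, mul_comm] at hα
  have hc0 : 0 < c := lt_of_lt_of_le (by positivity) hkα
  have hbR : ∀ n, BddAbove {r : ℝ | ∃ (σ : List ℕ) (f' : ℕ → ℝ), σ.length = n ∧ ValidSeq k σ ∧
          ValidPred k f' ∧ r = (pCost A f' σ : ℝ) / (OPT k ↑σ : ℝ)} := by
    intro n
    refine ⟨k, ?_⟩
    rintro r ⟨σ, f', -, hv, -, rfl⟩
    exact ratio_le A f' hv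
  have hbC : ∀ n, BddAbove {r : ℝ | ∃ σ : List ℕ, σ.length = n ∧ ValidSeq k σ ∧
          r = (pCost A (freq σ) σ : ℝ) / (OPT k ↑σ : ℝ)} := by
    intro n
    refine ⟨k, ?_⟩
    rintro r ⟨σ, -, hv, rfl⟩
    exact ratio_le A _ hv
  set ε : ℝ := (1 - c) / (2 * k) with hε
  have hε0 : 0 < ε := div_pos (by linarith) (by positivity)
  have hkε : k * ε = (1 - c) / 2 := by rw [hε]; field_simp
  have hev := Filter.eventually_lt_of_limsup_lt (lt_of_le_of_lt hcons
    (show 1 + α < 1 + α + ε by linarith)) (by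
      refine Filter.isBoundedUnder_of ⟨k, fun n => ?_⟩
      refine Real.sSup_le ?_ hk0.le
      rintro r ⟨σ, -, hv, rfl⟩
      exact ratio_le A _ hv)
  obtain ⟨N, hN⟩ := Filter.eventually_atTop.1 hev
  refine Filter.le_limsup_of_frequently_le ?_ ?_
  swap
  · refine Filter.isBoundedUnder_of ⟨k, fun n => ?_⟩
    refine Real.sSup_le ?_ hk0.le
    rintro r ⟨σ, f', -, hv, -, rfl⟩
    exact ratio_le A _ hv
  rw [Filter.frequently_atTop]
  intro M
  set j := M + N + 1 with hj
  set m := k * j with hm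
  have hjm : j ≤ m := Nat.le_mul_of_pos_left _ (by omega)
  refine ⟨m, by omega, ?_⟩
  have hp := validPred_freq k (seq2 k m)
  have hv1 := validSeq_ones hk m
  refine le_trans ?_ (le_csSup (hbR m) ⟨List.replicate m 1, freq (seq2 k m), by simp, hv1, hp, rfl⟩)
  have hO1 : OPT k ↑(List.replicate m 1) ≤ j := OPT_ones k j
  have hO1p : 0 < OPT k ↑(List.replicate m 1) := by
    have := length_le_OPT hv1
    rw [List.length_replicate] at this
    exact Nat.pos_of_ne_zero (fun h => by rw [h] at this; omega)
  have hO1' : (OPT k ↑(List.replicate m 1) : ℝ) ≤ j := by exact_mod_cast hO1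
  have hO1p' : (0 : ℝ) < OPT k ↑(List.replicate m 1) := by exact_mod_cast hO1p
  rw [le_div_iff₀ hO1p']
  have hmj : (m : ℝ) = k * j := by rw [hm]; push_cast; ring
  have hj0 : (0 : ℝ) < j := by exact_mod_cast (by omega : 0 < j)
  have hpos : 0 ≤ (1 - c) * k / 2 := by
    have : 0 ≤ 1 - c := by linarith
    positivity
  refine le_trans (mul_le_mul_of_nonneg_left hO1' hpos) ?_
  rcases Nat.lt_or_ge k 3 with h3 | h3
  · have hk2 : k = 2 := by omega
    have h := ones_cost hk hfeas hp m
    have h' : j ≤ pCost A (freq (seq2 k m)) (List.replicate m 1) := by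
      exact le_of_mul_le_mul_left h (by omega : 0 < k)
    have h'' : (j : ℝ) ≤ pCost A (freq (seq2 k m)) (List.replicate m 1) := by exact_mod_cast h'
    have hkk : (k : ℝ) = 2 := by exact_mod_cast hk2
    rw [hkk]
    nlinarith
  · have h := key h3 hfeas hp m
    have hv2 := validSeq_seq2 hk m
    have hlt := lt_of_le_of_lt (le_csSup (hbC (2 * m)) ⟨seq2 k m, seq2_length k m, hv2, rfl⟩)
      (hN (2 * m) (by omega))
    have hO2p : 0 < OPT k ↑(seq2 k m) := by
      have := length_le_OPT hv2
      rw [seq2_length] at this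
      exact Nat.pos_of_ne_zero (fun h => by rw [h] at this; omega)
    have hO2p' : (0 : ℝ) < OPT k ↑(seq2 k m) := by exact_mod_cast hO2p
    have hO2 : (OPT k ↑(seq2 k m) : ℝ) ≤ m := by exact_mod_cast OPT_seq2 hk m
    rw [div_lt_iff₀ hO2p'] at hlt
    have hcost := hlt.le.trans (mul_le_mul_of_nonneg_left hO2 (by linarith : 0 ≤ 1 + α + ε))
    have hR : (m : ℝ) + k * m ≤ pCost A (freq (seq2 k m)) (List.replicate m 1)
        + k * pCost A (freq (seq2 k m)) (seq2 k m) := by exact_mod_cast h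
    have e1 := mul_le_mul_of_nonneg_left hcost hk0.le
    have hm0 : (0 : ℝ) ≤ m := by positivity
    have e2 : k * ((1 + α + ε) * m) ≤ (k + c + (1 - c) / 2) * m := by
      rw [← hkε]
      nlinarith [mul_le_mul_of_nonneg_right hkα hm0]
    have e3 : (1 - c) * k / 2 * j = (1 - c) / 2 * m := by rw [hmj]; ring
    rw [e3]
    nlinarith

end BinPackingWithPredictions
end

section
/- Let A be an algorithm with frequency predictions whose asymptotic competitive ratio on inputs consisting solely of items of integral size is c. Define d̂(σ) = (Σ_{x ∈ σ, x not an integer} x) / (Σ_{x ∈ σ} x). Let A' be the algorithm that serves the integral-size items of σ using A and serves the fractional (non-integral) items separately using FirstFit. Then for every δ ∈ [0, 1], the asymptotic competitive ratio of A' over fractional inputs σ with d̂(σ) ≤ δ is at most c + 2δ; more precisely, |A'(σ)| ≤ c·OPT(σ) + 2·d̂(σ)·OPT(σ) + O(1) for every input σ. -/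
open scoped BigOperators Classical

namespace BinPackingWithPredictions

/-! ## Bin packing in the fractional setting -/

def IsPackingR (k : ℝ) (S : Multiset ℝ) (L : Multiset (Multiset ℝ)) : Prop :=
  L.sum = S ∧ ∀ B ∈ L, B.sum ≤ k

noncomputable def OPTR (k : ℝ) (S : Multiset ℝ) : ℕ :=
  sInf {N | ∃ L, IsPackingR k S L ∧ L.card = N}

/-- A valid fractional input: every item has real size in `(0,k]`. -/
def ValidSeqR (k : ℝ) (σ : List ℝ) : Prop := ∀ a ∈ σ, 0 < a ∧ a ≤ k

/-- The deviation `d(σ) = Σ_{x ∈ σ} |x − ⌊x⌉|`, where `⌊x⌉` is the nearest integer. -/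
noncomputable def dev (σ : List ℝ) : ℝ := (σ.map fun x => |x - (round x : ℝ)|).sum

/-- The frequency of the integer size `x` in the rounded sequence `⌊σ⌉`. -/
noncomputable def freqR (σ : List ℝ) (x : ℕ) : ℝ :=
  ((σ.filter fun a => decide (round a = (x : ℤ))).length : ℝ) / (σ.length : ℝ)

noncomputable def ffStepR (k : ℝ) : List ℝ → ℝ → List ℝ
  | [], x => [x]
  | b :: rest, x => if b + x ≤ k then (b + x) :: rest else b :: ffStepR k rest x

/-- The number of bins FirstFit opens on the real-valued sequence `σ`. -/
noncomputable def FFR (k : ℝ) (σ : List ℝ) : ℕ := (σ.foldl (ffStepR k) []).length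

/-- An online algorithm with frequency predictions in the fractional setting. -/
def rAssign (A : (ℕ → ℝ) → List ℝ → ℕ) (f' : ℕ → ℝ) (σ : List ℝ) (i : ℕ) : ℕ :=
  A f' (σ.take (i + 1))

noncomputable def rLoad (A : (ℕ → ℝ) → List ℝ → ℕ) (f' : ℕ → ℝ) (σ : List ℝ) (b : ℕ) : ℝ :=
  ∑ i ∈ Finset.range σ.length, if rAssign A f' σ i = b then σ.getD i 0 else 0

def RFeasible (k : ℝ) (A : (ℕ → ℝ) → List ℝ → ℕ) : Prop :=
  ∀ f' σ, ValidSeqR k σ → ∀ b, rLoad A f' σ b ≤ k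

def rCost (A : (ℕ → ℝ) → List ℝ → ℕ) (f' : ℕ → ℝ) (σ : List ℝ) : ℕ :=
  ((Finset.range σ.length).image (rAssign A f' σ)).card

/-- The items of `σ` with integral size, as natural numbers. -/
noncomputable def intPart (σ : List ℝ) : List ℕ :=
  (σ.filter fun x => decide (∃ z : ℤ, (z : ℝ) = x)).map fun x => ⌊x⌋₊

/-- The items of `σ` with fractional (non-integral) size. -/
noncomputable def fracPart (σ : List ℝ) : List ℝ :=
  σ.filter fun x => decide (¬ ∃ z : ℤ, (z : ℝ) = x)

/-- `d̂(σ)`: the total size of the fractional items over the total size of all items. -/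
noncomputable def dHat (σ : List ℝ) : ℝ := (fracPart σ).sum / σ.sum



/-! ## Helper lemmas -/

lemma aux_mem (k : ℝ) (x : ℝ) (hx : 0 ≤ x) : ∀ (L : List ℝ) (y : ℝ),
    y ∈ ffStepR k L x → (∃ r ∈ L, r ≤ y) ∨ y = x := by
  intro L
  induction L with
  | nil => intro y hy; right; simpa [ffStepR] using hy
  | cons b rest ih =>
    intro y hy
    unfold ffStepR at hy
    split_ifs at hy with h
    · rcases List.mem_cons.1 hy with h1 | h1
      · left; exact ⟨b, by simp, by linarith⟩
      · left; exact ⟨y, by simp [h1], le_rfl⟩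
    · rcases List.mem_cons.1 hy with h1 | h1
      · left; exact ⟨b, by simp, by linarith⟩
      · rcases ih y h1 with ⟨r, hr, hry⟩ | h2
        · left; exact ⟨r, by simp [hr], hry⟩
        · right; exact h2

lemma aux_sum (k : ℝ) (x : ℝ) : ∀ (L : List ℝ), (ffStepR k L x).sum = L.sum + x := by
  intro L
  induction L with
  | nil => simp [ffStepR]
  | cons b rest ih =>
    unfold ffStepR
    split_ifs with h
    · simp; ring
    · simp [ih]; ring

lemma aux_pw (k : ℝ) (x : ℝ) (hx : 0 ≤ x) : ∀ (L : List ℝ),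
    L.Pairwise (fun a b => k < a + b) → (ffStepR k L x).Pairwise (fun a b => k < a + b) := by
  intro L
  induction L with
  | nil => intro _; simp [ffStepR]
  | cons b rest ih =>
    intro hp
    rw [List.pairwise_cons] at hp
    unfold ffStepR
    split_ifs with h
    · rw [List.pairwise_cons]
      exact ⟨fun a ha => by linarith [hp.1 a ha], hp.2⟩
    · rw [List.pairwise_cons]
      refine ⟨fun a ha => ?_, ih hp.2⟩
      rcases aux_mem k x hx rest a ha with ⟨r, hr, hra⟩ | h2
      · linarith [hp.1 r hr]
      · subst h2; linarith

lemma aux_len (k : ℝ) : ∀ (L : List ℝ), L.Pairwise (fun a b => k < a + b) →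
    (∀ a ∈ L, 0 ≤ a) → 0 ≤ k → (L.length : ℝ) * k ≤ 2 * L.sum + k
  | [], _, _, hk => by simpa using hk
  | [a], _, h, hk => by
    have := h a (by simp)
    simp; linarith
  | a :: b :: rest, hp, h, hk => by
    rw [List.pairwise_cons, List.pairwise_cons] at hp
    have h1 := hp.1 b (by simp)
    have h2 := aux_len k rest hp.2.2 (fun a ha => h a (by simp [ha])) hk
    simp only [List.length_cons, List.sum_cons]
    push_cast
    nlinarith

lemma aux_fold (k : ℝ) : ∀ (σ L : List ℝ), (∀ a ∈ σ, 0 ≤ a) → (∀ a ∈ L, 0 ≤ a) →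
    L.Pairwise (fun a b => k < a + b) →
    (∀ a ∈ σ.foldl (ffStepR k) L, 0 ≤ a) ∧
    (σ.foldl (ffStepR k) L).Pairwise (fun a b => k < a + b) ∧
    (σ.foldl (ffStepR k) L).sum = L.sum + σ.sum := by
  intro σ
  induction σ with
  | nil => intro L _ h2 h3; simpa using ⟨h2, h3⟩
  | cons x σ ih =>
    intro L h1 h2 h3
    have hx := h1 x (by simp)
    have := ih (ffStepR k L x) (fun a ha => h1 a (by simp [ha])) (by
      intro a ha
      rcases aux_mem k x hx L a ha with ⟨r, hr, hra⟩ | h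
      · exact (h2 r hr).trans hra
      · rw [h]; exact hx) (aux_pw k x hx L h3)
    rw [List.foldl_cons]
    refine ⟨this.1, this.2.1, ?_⟩
    rw [this.2.2, aux_sum, List.sum_cons]; ring

lemma aux_FFR (k : ℝ) (hk : 0 ≤ k) (σ : List ℝ) (h : ∀ a ∈ σ, 0 ≤ a) :
    (FFR k σ : ℝ) * k ≤ 2 * σ.sum + k := by
  obtain ⟨h1, h2, h3⟩ := aux_fold k σ [] h (by simp) (by simp)
  have := aux_len k _ h2 h1 hk
  rw [h3] at this
  simpa [FFR] using this

lemma aux_exR (k : ℝ) (σ : List ℝ) (h : ValidSeqR k σ) :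
    ∃ L, IsPackingR k (↑σ) L ∧ L.card = OPTR k ↑σ := by
  have : OPTR k ↑σ ∈ {N | ∃ L, IsPackingR k (↑σ : Multiset ℝ) L ∧ L.card = N} := by
    apply Nat.sInf_mem
    refine ⟨_, (↑σ : Multiset ℝ).map (fun a => {a}), ⟨Multiset.sum_map_singleton _, ?_⟩, rfl⟩
    intro B hB
    obtain ⟨a, ha, rfl⟩ := Multiset.mem_map.1 hB
    simpa using (h a (by simpa using ha)).2
  exact this

lemma aux_ex (k : ℕ) (σ : List ℕ) (h : ValidSeq k σ) :
    ∃ L, IsPacking k (↑σ) L ∧ L.card = OPT k ↑σ := by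
  have : OPT k ↑σ ∈ {N | ∃ L, IsPacking k (↑σ : Multiset ℕ) L ∧ L.card = N} := by
    apply Nat.sInf_mem
    refine ⟨_, (↑σ : Multiset ℕ).map (fun a => {a}), ⟨Multiset.sum_map_singleton _, ?_⟩, rfl⟩
    intro B hB
    obtain ⟨a, ha, rfl⟩ := Multiset.mem_map.1 hB
    simpa using (h a (by simpa using ha)).2
  exact this

lemma aux_sizeR (k : ℝ) (L : Multiset (Multiset ℝ)) (h : ∀ B ∈ L, B.sum ≤ k) :
    L.sum.sum ≤ L.card * k := by
  induction L using Multiset.induction with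
  | empty => simp
  | cons B L ih =>
    have h1 := h B (by simp)
    have h2 := ih (fun B hB => h B (by simp [hB]))
    simp only [Multiset.sum_cons, Multiset.sum_add, Multiset.card_cons]
    push_cast
    linarith

lemma aux_size (k : ℕ) (L : Multiset (Multiset ℕ)) (h : ∀ B ∈ L, B.sum ≤ k) :
    L.sum.sum ≤ L.card * k := by
  induction L using Multiset.induction with
  | empty => simp
  | cons B L ih =>
    have h1 := h B (by simp)
    have h2 := ih (fun B hB => h B (by simp [hB]))
    simp only [Multiset.sum_cons, Multiset.sum_add, Multiset.card_cons]
    linarith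

/-- the integral items of a multiset -/
noncomputable def auxInt (B : Multiset ℝ) : Multiset ℕ :=
  (B.filter fun x => ∃ z : ℤ, (z : ℝ) = x).map fun x => ⌊x⌋₊

lemma auxInt_sum (L : Multiset (Multiset ℝ)) : (L.map auxInt).sum = auxInt L.sum := by
  induction L using Multiset.induction with
  | empty => simp [auxInt]
  | cons B L ih =>
    simp only [Multiset.map_cons, Multiset.sum_cons, ih]
    simp [auxInt, Multiset.filter_add]

lemma auxInt_le (B : Multiset ℝ) (h : ∀ a ∈ B, 0 ≤ a) : ((auxInt B).sum : ℝ) ≤ B.sum := by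
  induction B using Multiset.induction with
  | empty => simp [auxInt]
  | cons a B ih =>
    have h1 := h a (by simp)
    have h2 := ih (fun B hB => h B (by simp [hB]))
    have h3 := Nat.floor_le h1
    by_cases hz : ∃ z : ℤ, (z : ℝ) = a
    · have : auxInt (a ::ₘ B) = ⌊a⌋₊ ::ₘ auxInt B := by
        unfold auxInt
        rw [Multiset.filter_cons_of_pos (p := fun x : ℝ => ∃ z : ℤ, (z : ℝ) = x) _ hz, Multiset.map_cons]
      rw [this, Multiset.sum_cons, Multiset.sum_cons, Nat.cast_add]
      linarith
    · have : auxInt (a ::ₘ B) = auxInt B := by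
        unfold auxInt
        rw [Multiset.filter_cons_of_neg (p := fun x : ℝ => ∃ z : ℤ, (z : ℝ) = x) _ hz]
      rw [this, Multiset.sum_cons]
      linarith

lemma aux_OPT_le (k : ℕ) (σ : List ℝ) (h : ValidSeqR k σ) :
    OPT k ↑(intPart σ) ≤ OPTR k ↑σ := by
  obtain ⟨L, ⟨hL, hB⟩, hc⟩ := aux_exR k σ h
  rw [← hc]
  apply Nat.sInf_le
  refine ⟨L.map auxInt, ⟨?_, ?_⟩, by simp⟩
  · rw [auxInt_sum, hL]
    simp [auxInt, intPart]
  · intro B hB'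
    obtain ⟨D, hD, rfl⟩ := Multiset.mem_map.1 hB'
    have h0 : ∀ a ∈ D, 0 ≤ a := by
      intro a ha
      have : a ∈ L.sum := Multiset.mem_of_le (Multiset.single_le_sum (fun _ _ => zero_le) D hD) ha
      rw [hL] at this
      exact (h a (by simpa using this)).1.le
    have := (auxInt_le D h0).trans (hB D hD)
    exact_mod_cast this

lemma aux_valid (k : ℕ) (σ : List ℝ) (h : ValidSeqR k σ) : ValidSeq k (intPart σ) := by
  intro a ha
  unfold intPart at ha
  obtain ⟨x, hx, rfl⟩ := List.mem_map.1 ha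
  rw [List.mem_filter] at hx
  obtain ⟨hx, hz⟩ := hx
  obtain ⟨z, rfl⟩ := of_decide_eq_true hz
  obtain ⟨h1, h2⟩ := h _ hx
  constructor
  · rw [Nat.one_le_floor_iff]
    have : 0 < z := by exact_mod_cast h1
    exact_mod_cast this
  · exact Nat.floor_le_of_le h2

lemma aux_c (k : ℕ) (hk : 1 ≤ k) (c C : ℝ) (A : (ℕ → ℝ) → List ℕ → ℕ)
    (hA : ∀ (f' : ℕ → ℝ) (σ : List ℕ), ValidPred k f' → ValidSeq k σ →
      (pCost A f' σ : ℝ) ≤ c * (OPT k ↑σ : ℝ) + C) : 0 ≤ c := by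
  by_contra! hc
  obtain ⟨n, hn⟩ := exists_nat_gt (C / (-c))
  have hv : ValidSeq k (List.replicate n k) := by
    intro a ha
    rw [(List.mem_replicate.1 ha).2]; exact ⟨hk, le_rfl⟩
  have h1 := hA (fun _ => 0) _ (fun x _ => by simp) hv
  obtain ⟨L, ⟨hL, hB⟩, hcard⟩ := aux_ex k _ hv
  have h2 := aux_size k L hB
  rw [hL, hcard] at h2
  have h3 : n * k ≤ OPT k ↑(List.replicate n k) * k := by simpa using h2
  have h4 : n ≤ OPT k ↑(List.replicate n k) := Nat.le_of_mul_le_mul_right h3 hk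
  have h5 : (n : ℝ) ≤ (OPT k ↑(List.replicate n k) : ℝ) := by exact_mod_cast h4
  have h6 : (0 : ℝ) ≤ pCost A (fun _ => 0) (List.replicate n k) := by positivity
  rw [div_lt_iff₀ (by linarith)] at hn
  nlinarith

lemma aux_main (k : ℕ) (hk : 1 ≤ k) (σ : List ℝ) (h : ValidSeqR k σ) :
    (FFR (k : ℝ) (fracPart σ) : ℝ) ≤ 2 * dHat σ * (OPTR (k : ℝ) ↑σ : ℝ) + 1 := by
  have hk0 : (0 : ℝ) < k := by exact_mod_cast hk
  have hf : ∀ a ∈ fracPart σ, 0 ≤ a := fun a ha => (h a (List.mem_of_mem_filter ha)).1.le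
  have h1 := aux_FFR k hk0.le (fracPart σ) hf
  obtain ⟨L, ⟨hL, hB⟩, hc⟩ := aux_exR k σ h
  have h2 := aux_sizeR k L hB
  rw [hL, hc, Multiset.sum_coe] at h2
  have h3 : (fracPart σ).sum ≤ dHat σ * (OPTR (k : ℝ) ↑σ : ℝ) * k := by
    rcases eq_or_ne σ [] with rfl | hne
    · simp [fracPart, dHat]
    · have hpos : 0 < σ.sum := List.sum_pos σ (fun a ha => (h a ha).1) hne
      have hd : 0 ≤ dHat σ := div_nonneg (List.sum_nonneg hf) hpos.le
      calc (fracPart σ).sum = dHat σ * σ.sum := by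
            unfold dHat; field_simp
        _ ≤ dHat σ * (OPTR (k : ℝ) ↑σ * k) := mul_le_mul_of_nonneg_left h2 hd
        _ = _ := by ring
  refine le_of_mul_le_mul_right ?_ hk0
  linarith

/-- Let `A` be an algorithm with frequency predictions whose asymptotic
competitive ratio on inputs consisting solely of items of integral size is `c` (i.e.,
its cost is at most `c·OPT + O(1)` on such inputs).  Let `A'` serve the integral-size items
of `σ` using `A` and the fractional items separately using FirstFit.  Then for every
`δ ∈ [0,1]`, the asymptotic competitive ratio of `A'` over fractional inputs `σ` with
`d̂(σ) ≤ δ` is at most `c + 2δ`; more precisely,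
`|A'(σ)| ≤ c·OPT(σ) + 2·d̂(σ)·OPT(σ) + O(1)` for every input `σ`. -/
theorem fractional_items_extension
    (k : ℕ) (hk : 1 ≤ k) (c : ℝ)
    (A : (ℕ → ℝ) → List ℕ → ℕ) (hfeas : PFeasible k A)
    (hA : ∃ C : ℝ, ∀ (f' : ℕ → ℝ) (σ : List ℕ), ValidPred k f' → ValidSeq k σ →
      (pCost A f' σ : ℝ) ≤ c * (OPT k ↑σ : ℝ) + C) :
    (∀ δ : ℝ, 0 ≤ δ → δ ≤ 1 → ∃ C : ℝ, ∀ (f' : ℕ → ℝ) (σ : List ℝ),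
        ValidPred k f' → ValidSeqR (k : ℝ) σ → dHat σ ≤ δ →
        ((pCost A f' (intPart σ) + FFR (k : ℝ) (fracPart σ) : ℕ) : ℝ)
          ≤ (c + 2 * δ) * (OPTR (k : ℝ) ↑σ : ℝ) + C) ∧
    (∃ C : ℝ, ∀ (f' : ℕ → ℝ) (σ : List ℝ), ValidPred k f' → ValidSeqR (k : ℝ) σ →
        ((pCost A f' (intPart σ) + FFR (k : ℝ) (fracPart σ) : ℕ) : ℝ)
          ≤ c * (OPTR (k : ℝ) ↑σ : ℝ) + 2 * dHat σ * (OPTR (k : ℝ) ↑σ : ℝ) + C) := by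
  obtain ⟨C, hA⟩ := hA
  have hc := aux_c k hk c C A hA
  have key : ∀ (f' : ℕ → ℝ) (σ : List ℝ), ValidPred k f' → ValidSeqR (k : ℝ) σ →
        ((pCost A f' (intPart σ) + FFR (k : ℝ) (fracPart σ) : ℕ) : ℝ)
          ≤ c * (OPTR (k : ℝ) ↑σ : ℝ) + 2 * dHat σ * (OPTR (k : ℝ) ↑σ : ℝ) + (C + 1) := by
    intro f' σ hf hσ
    have h1 := hA f' _ hf (aux_valid k σ hσ)
    have h2 := aux_main k hk σ hσ
    have h3 : (OPT k ↑(intPart σ) : ℝ) ≤ (OPTR (k : ℝ) ↑σ : ℝ) := by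
      exact_mod_cast aux_OPT_le k σ hσ
    have h4 := mul_le_mul_of_nonneg_left h3 hc
    push_cast
    linarith
  refine ⟨fun δ _ _ => ⟨C + 1, fun f' σ hf hσ hd => ?_⟩, C + 1, key⟩
  have h1 := key f' σ hf hσ
  have h2 := mul_le_mul_of_nonneg_right hd (Nat.cast_nonneg (α := ℝ) (OPTR (k : ℝ) ↑σ))
  linarith

end BinPackingWithPredictions
end

section
/- Let n, m, g be positive integers and n_x a nonnegative integer such that g ≤ ⌈n/m⌉, n_x ≤ n, and m² < n. Then ⌈n_x/g⌉ > ⌈n_x·m/n⌉ − 2. -/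
/-- Let `n, m, g` be positive integers and `n_x` a nonnegative integer
such that `g ≤ ⌈n/m⌉`, `n_x ≤ n`, and `m² < n`.  Then `⌈n_x/g⌉ > ⌈n_x·m/n⌉ − 2`
(ceilings of exact division over the reals). -/
theorem ceil_div_key_estimate (n m g nx : ℕ) (hn : 0 < n) (hm : 0 < m) (hg : 0 < g)
    (hgle : (g : ℤ) ≤ ⌈(n : ℝ) / (m : ℝ)⌉) (hnx : nx ≤ n) (hmn : m ^ 2 < n) :
    ⌈((nx : ℝ) * (m : ℝ)) / (n : ℝ)⌉ - 2 < ⌈(nx : ℝ) / (g : ℝ)⌉ := by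
  have hn' : (0:ℝ) < n := by exact_mod_cast hn
  have hm' : (0:ℝ) < m := by exact_mod_cast hm
  have hg' : (0:ℝ) < g := by exact_mod_cast hg
  have hx0 : (0:ℝ) ≤ nx := Nat.cast_nonneg nx
  have hx : (nx:ℝ) ≤ n := by exact_mod_cast hnx
  have hmn' : (m:ℝ) ^ 2 < n := by exact_mod_cast hmn
  have h1 : (g:ℝ) < n / m + 1 := by
    have h2 : (g:ℝ) ≤ (⌈(n : ℝ) / (m : ℝ)⌉ : ℤ) := by exact_mod_cast hgle
    exact lt_of_le_of_lt h2 (Int.ceil_lt_add_one _)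
  have h3 : (g:ℝ) * m ≤ n + m := by
    have h4 := mul_lt_mul_of_pos_right h1 hm'
    have h5 : ((n:ℝ) / m + 1) * m = n + m := by field_simp
    linarith
  have h6 : (nx:ℝ) * m / (n + m) ≤ nx / g := by
    rw [div_le_div_iff₀ (by positivity) hg']
    nlinarith [mul_le_mul_of_nonneg_left h3 hx0]
  have h7 : (nx:ℝ) * m / n ≤ nx * m / (n + m) + 1 := by
    rw [div_add_one (by positivity), div_le_div_iff₀ hn' (by positivity)]
    have h8 : (nx:ℝ) * m ^ 2 ≤ n * n := mul_le_mul hx hmn'.le (by positivity) hn'.le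
    nlinarith [mul_pos hn' hm']
  have h9 : ⌈((nx : ℝ) * (m : ℝ)) / (n : ℝ)⌉ ≤ ⌈(nx : ℝ) / (g : ℝ)⌉ + 1 := by
    rw [Int.ceil_le]
    push_cast
    linarith [Int.le_ceil ((nx : ℝ) / (g : ℝ))]
  linarith
end
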